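/- Let η be a random vector in ℝ^d with 𝔼[e^{λ|η|}] < ∞ for every λ > 0, let x₀ ∈ ℝ^d and ε > 0, and let σ, β : [0,1] → [0,1] be C¹ functions with β_t = 1 − σ_t, σ₀ = 1, σ₁ = 0, and σ'_t < 0 for t ∈ [0,1). For t ∈ (0,1) define D_t(x) := 𝔼[η e^{−|x − β_t η − σ_t x₀|²/(2εβ_tσ_t)}] / 𝔼[e^{−|x − β_t η − σ_t x₀|²/(2εβ_tσ_t)}]. Then for each t ∈ (0,1), the map x ↦ D_t(x) is differentiable, and for every t₀ ∈ (0,1) and R > 0, sup { ‖∇_x D_t(x)‖ : t ∈ (0, t₀], |x| ≤ R } < ∞. -/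

import Mathlib

open MeasureTheory ProbabilityTheory
open scoped ENNReal

theorem norm_le_exp_norm {V : Type*} [NormedAddCommGroup V] (v : V) : ‖v‖ ≤ Real.exp ‖v‖ := by
  linarith [Real.add_one_le_exp ‖v‖]

theorem le_exp_two_mul_norm {V : Type*} [NormedAddCommGroup V] {v : V} {a : ℝ}
    (ha : a ≤ Real.exp ‖v‖) : a ≤ Real.exp (2 * ‖v‖) :=
  ha.trans (Real.exp_le_exp.mpr (by linarith [norm_nonneg v]))

theorem integral_exp_neg_norm_pos {Ω V : Type*} [MeasurableSpace Ω]
    {P : Measure Ω} [IsProbabilityMeasure P] [NormedAddCommGroup V] [MeasurableSpace V]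
    [BorelSpace V] {X : Ω → V} (hX : Measurable X) {L C : ℝ}
    (hL : 0 ≤ L) (hC : 0 ≤ C) :
    0 < ∫ ω, Real.exp (-(L * ‖X ω‖) - C * ‖X ω‖ ^ 2) ∂P := by
  refine integral_exp_pos (Integrable.of_bound (C := 1) ?_ (.of_forall fun ω => ?_))
  · have h : Continuous fun v : V => Real.exp (-(L * ‖v‖) - C * ‖v‖ ^ 2) := by fun_prop
    exact (h.measurable.comp hX).aestronglyMeasurable
  · rw [Real.norm_eq_abs, Real.abs_exp, Real.exp_le_one_iff]
    have h1 : 0 ≤ L * ‖X ω‖ := by positivity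
    have h2 : 0 ≤ C * ‖X ω‖ ^ 2 := by positivity
    linarith

section ExponentialTilt

variable {Ω E F : Type*} [MeasurableSpace Ω] {P : Measure Ω}
  [NormedAddCommGroup E] [InnerProductSpace ℝ E] [NormedAddCommGroup F] [NormedSpace ℝ F]

theorem tilt_weight_le {y v : E} {L c : ℝ} (hy : ‖y‖ ≤ L) (hc : 0 ≤ c) :
    Real.exp (inner ℝ y v - c * ‖v‖ ^ 2) ≤ Real.exp (L * ‖v‖) := by
  apply Real.exp_le_exp.mpr
  have h1 := real_inner_le_norm y v
  have h2 : ‖y‖ * ‖v‖ ≤ L * ‖v‖ := by gcongr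
  have h3 : 0 ≤ c * ‖v‖ ^ 2 := by positivity
  linarith

theorem norm_tilt_smul_le {y v : E} {u : F} {L c : ℝ} (hy : ‖y‖ ≤ L) (hc : 0 ≤ c)
    (hu : ‖u‖ ≤ Real.exp (2 * ‖v‖)) :
    ‖Real.exp (inner ℝ y v - c * ‖v‖ ^ 2) • u‖ ≤ Real.exp ((L + 2) * ‖v‖) := by
  rw [norm_smul, Real.norm_eq_abs, Real.abs_exp, add_mul, Real.exp_add]
  exact mul_le_mul (tilt_weight_le hy hc) hu (norm_nonneg _) (Real.exp_pos _).le

theorem norm_smulRight_innerSL_le {v : E} {u : F} (hu : ‖u‖ ≤ Real.exp ‖v‖) :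
    ‖(innerSL ℝ v).smulRight u‖ ≤ Real.exp (2 * ‖v‖) := by
  rw [ContinuousLinearMap.norm_smulRight_apply, innerSL_apply_norm, two_mul, Real.exp_add]
  gcongr
  exact norm_le_exp_norm v

theorem gaussian_weight_eq_tilt {x x₀ v : E} {ε b s : ℝ} (hε : ε ≠ 0) (hb : b ≠ 0)
    (hs : s ≠ 0) :
    Real.exp (-‖x - b • v - s • x₀‖ ^ 2 / (2 * ε * b * s)) =
      Real.exp (-‖x - s • x₀‖ ^ 2 / (2 * ε * b * s)) *
        Real.exp (inner ℝ ((ε * s)⁻¹ • (x - s • x₀)) v - b / (2 * ε * s) * ‖v‖ ^ 2) := by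
  rw [← Real.exp_add, sub_right_comm, norm_sub_sq_real, real_inner_smul_left,
    real_inner_smul_right, norm_smul, mul_pow, Real.norm_eq_abs, sq_abs]
  congr 1
  field_simp
  ring

variable {X : Ω → E}

/-- The mean of `X` under the tilted measure with density proportional to
`exp (⟪y, X⟫ - c * ‖X‖ ^ 2)`. -/
noncomputable def tiltMean (P : Measure Ω) (X : Ω → E) (c : ℝ) (y : E) : E :=
  (∫ ω, Real.exp (inner ℝ y (X ω) - c * ‖X ω‖ ^ 2) ∂P)⁻¹ •
    ∫ ω, Real.exp (inner ℝ y (X ω) - c * ‖X ω‖ ^ 2) • X ω ∂P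

theorem gaussian_mean_eq_tiltMean {x x₀ : E} {ε b s : ℝ} (hε : ε ≠ 0) (hb : b ≠ 0)
    (hs : s ≠ 0) :
    (∫ ω, Real.exp (-‖x - b • X ω - s • x₀‖ ^ 2 / (2 * ε * b * s)) ∂P)⁻¹ •
        ∫ ω, Real.exp (-‖x - b • X ω - s • x₀‖ ^ 2 / (2 * ε * b * s)) • X ω ∂P =
      tiltMean P X (b / (2 * ε * s)) ((ε * s)⁻¹ • (x - s • x₀)) := by
  simp only [gaussian_weight_eq_tilt hε hb hs, mul_smul, integral_const_mul, integral_smul,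
    tiltMean]
  rw [smul_smul, mul_inv_rev, inv_mul_cancel_right₀ (Real.exp_pos _).ne']

theorem norm_integral_tilt_smul_le
    (hexp : ∀ l : ℝ, 0 < l → Integrable (fun ω => Real.exp (l * ‖X ω‖)) P) {Y : Ω → F}
    (hYX : ∀ ω, ‖Y ω‖ ≤ Real.exp (2 * ‖X ω‖)) {y : E}
    {c L : ℝ} (hc : 0 ≤ c) (hy : ‖y‖ ≤ L) :
    ‖∫ ω, Real.exp (inner ℝ y (X ω) - c * ‖X ω‖ ^ 2) • Y ω ∂P‖
      ≤ ∫ ω, Real.exp ((L + 2) * ‖X ω‖) ∂P :=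
  norm_integral_le_of_norm_le (hexp (L + 2) (by linarith [norm_nonneg y]))
    (.of_forall fun ω => norm_tilt_smul_le hy hc (hYX ω))

variable [MeasurableSpace E] [BorelSpace E]

theorem aestronglyMeasurable_tilt_smul (hX : Measurable X) {Y : Ω → F}
    (hY : AEStronglyMeasurable Y P) (y : E) (c : ℝ) :
    AEStronglyMeasurable
      (fun ω => Real.exp (inner ℝ y (X ω) - c * ‖X ω‖ ^ 2) • Y ω) P := by
  have h : Continuous fun v : E => Real.exp (inner ℝ y v - c * ‖v‖ ^ 2) := by fun_prop
  exact (h.measurable.comp hX).aestronglyMeasurable.smul hY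

theorem integrable_tilt_smul (hX : Measurable X)
    (hexp : ∀ l : ℝ, 0 < l → Integrable (fun ω => Real.exp (l * ‖X ω‖)) P) {Y : Ω → F}
    (hY : AEStronglyMeasurable Y P) (hYX : ∀ ω, ‖Y ω‖ ≤ Real.exp (2 * ‖X ω‖)) (y : E)
    {c : ℝ} (hc : 0 ≤ c) :
    Integrable (fun ω => Real.exp (inner ℝ y (X ω) - c * ‖X ω‖ ^ 2) • Y ω) P :=
  (hexp (‖y‖ + 2) (by positivity)).mono' (aestronglyMeasurable_tilt_smul hX hY y c)
    (.of_forall fun ω => norm_tilt_smul_le le_rfl hc (hYX ω))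

theorem integral_tilt_ge [IsProbabilityMeasure P] (hX : Measurable X)
    (hexp : ∀ l : ℝ, 0 < l → Integrable (fun ω => Real.exp (l * ‖X ω‖)) P) {y : E}
    {c L C : ℝ} (hc : 0 ≤ c) (hy : ‖y‖ ≤ L) (hcC : c ≤ C) :
    ∫ ω, Real.exp (-(L * ‖X ω‖) - C * ‖X ω‖ ^ 2) ∂P
      ≤ ∫ ω, Real.exp (inner ℝ y (X ω) - c * ‖X ω‖ ^ 2) ∂P := by
  have hint := integrable_tilt_smul (Y := fun _ => (1 : ℝ)) hX hexp
    aestronglyMeasurable_const (fun ω => by simp) y hc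
  simp only [smul_eq_mul, mul_one] at hint
  refine integral_mono_of_nonneg (.of_forall fun ω => (Real.exp_pos _).le) hint
    (.of_forall fun ω => Real.exp_le_exp.mpr ?_)
  have h1 := neg_le_of_abs_le (abs_real_inner_le_norm y (X ω))
  have h2 : ‖y‖ * ‖X ω‖ ≤ L * ‖X ω‖ := by gcongr
  have h3 : c * ‖X ω‖ ^ 2 ≤ C * ‖X ω‖ ^ 2 := by gcongr
  linarith

variable [SecondCountableTopology E]

theorem hasFDerivAt_integral_tilt_smul (hX : Measurable X)
    (hexp : ∀ l : ℝ, 0 < l → Integrable (fun ω => Real.exp (l * ‖X ω‖)) P) {Y : Ω → F}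
    (hY : AEStronglyMeasurable Y P) (hYX : ∀ ω, ‖Y ω‖ ≤ Real.exp ‖X ω‖) (y : E)
    {c : ℝ} (hc : 0 ≤ c) :
    HasFDerivAt (fun z : E => ∫ ω, Real.exp (inner ℝ z (X ω) - c * ‖X ω‖ ^ 2) • Y ω ∂P)
      (∫ ω, Real.exp (inner ℝ y (X ω) - c * ‖X ω‖ ^ 2) •
        (innerSL ℝ (X ω)).smulRight (Y ω) ∂P) y := by
  have hXm : AEStronglyMeasurable X P := hX.aestronglyMeasurable
  have hZ : AEStronglyMeasurable (fun ω => (innerSL ℝ (X ω)).smulRight (Y ω)) P := by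
    have h : Continuous fun p : E × F => (innerSL ℝ p.1).smulRight p.2 :=
      (ContinuousLinearMap.smulRightL ℝ E F).continuous₂.comp
        (((innerSL ℝ).continuous.comp continuous_fst).prodMk continuous_snd)
    exact h.comp_aestronglyMeasurable (hXm.prodMk hY)
  refine hasFDerivAt_integral_of_dominated_of_fderiv_le
    (F' := fun z ω => Real.exp (inner ℝ z (X ω) - c * ‖X ω‖ ^ 2) •
        (innerSL ℝ (X ω)).smulRight (Y ω))
    (bound := fun ω => Real.exp ((‖y‖ + 1 + 2) * ‖X ω‖))
    (Metric.ball_mem_nhds y one_pos)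
    (.of_forall fun z => aestronglyMeasurable_tilt_smul hX hY z c)
    (integrable_tilt_smul hX hexp hY (fun ω => le_exp_two_mul_norm (hYX ω)) y hc)
    (aestronglyMeasurable_tilt_smul hX hZ y c) (.of_forall fun ω z hz => ?_)
    (hexp _ (by positivity)) (.of_forall fun ω z _ => ?_)
  · refine norm_tilt_smul_le ?_ hc (norm_smulRight_innerSL_le (hYX ω))
    have h1 : ‖z - y‖ < 1 := by simpa [dist_eq_norm] using hz
    linarith [norm_le_norm_add_norm_sub' z y]
  · have h1 : HasFDerivAt (fun z : E => inner ℝ z (X ω) - c * ‖X ω‖ ^ 2)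
        (innerSL ℝ (X ω)) z := by
      have := ((innerSL ℝ (X ω)).hasFDerivAt (x := z)).sub_const (c * ‖X ω‖ ^ 2)
      refine this.congr_of_eventuallyEq (.of_forall fun w => ?_)
      simp [real_inner_comm]
    refine (h1.exp.smul_const (Y ω)).congr_fderiv ?_
    ext v
    simp [smul_smul]

theorem exists_hasFDerivAt_tiltMean_norm_le [IsProbabilityMeasure P] (hX : Measurable X)
    (hexp : ∀ l : ℝ, 0 < l → Integrable (fun ω => Real.exp (l * ‖X ω‖)) P) {L C : ℝ}
    (hL : 0 ≤ L) (hC : 0 ≤ C) :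
    ∃ M : ℝ, ∀ c : ℝ, 0 ≤ c → c ≤ C → ∀ y : E, ‖y‖ ≤ L →
      ∃ A : E →L[ℝ] E, HasFDerivAt (tiltMean P X c) A y ∧ ‖A‖ ≤ M := by
  set K := ∫ ω, Real.exp ((L + 2) * ‖X ω‖) ∂P with hK
  set m := ∫ ω, Real.exp (-(L * ‖X ω‖) - C * ‖X ω‖ ^ 2) ∂P with hm
  have hmpos : 0 < m := integral_exp_neg_norm_pos hX hL hC
  have hK0 : 0 ≤ K := integral_nonneg fun ω => (Real.exp_pos _).le
  refine ⟨m⁻¹ * K + (m ^ 2)⁻¹ * K * K, fun c hc hcC y hy => ?_⟩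
  have hone : ∀ ω, ‖(1 : ℝ)‖ ≤ Real.exp ‖X ω‖ := fun ω => by simp
  have hself : ∀ ω, ‖X ω‖ ≤ Real.exp ‖X ω‖ := fun ω => norm_le_exp_norm (X ω)
  have hf := hasFDerivAt_integral_tilt_smul (Y := fun _ => (1 : ℝ)) hX hexp
    aestronglyMeasurable_const hone y hc
  have hg := hasFDerivAt_integral_tilt_smul hX hexp hX.aestronglyMeasurable hself y hc
  have hf' := norm_integral_tilt_smul_le hexp
    (fun ω => norm_smulRight_innerSL_le (hone ω)) hc hy
  have hg' := norm_integral_tilt_smul_le hexp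
    (fun ω => norm_smulRight_innerSL_le (hself ω)) hc hy
  have hg0 := norm_integral_tilt_smul_le hexp
    (fun ω => le_exp_two_mul_norm (hself ω)) hc hy
  simp only [smul_eq_mul, mul_one] at hf
  have hge : m ≤ ∫ ω, Real.exp (inner ℝ y (X ω) - c * ‖X ω‖ ^ 2) ∂P :=
    integral_tilt_ge hX hexp hc hy hcC
  have hinv := (hasDerivAt_inv (hmpos.trans_le hge).ne').comp_hasFDerivAt y hf
  refine ⟨_, hinv.smul hg, ?_⟩
  set f := ∫ ω, Real.exp (inner ℝ y (X ω) - c * ‖X ω‖ ^ 2) ∂P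
  have hfpos : 0 < f := hmpos.trans_le hge
  refine (norm_add_le _ _).trans (add_le_add ?_ ?_)
  · rw [norm_smul]
    refine mul_le_mul ?_ hg' (norm_nonneg _) (by positivity)
    simp only [Function.comp_apply, norm_inv, Real.norm_eq_abs]
    rw [abs_of_pos hfpos]
    gcongr
  · rw [ContinuousLinearMap.norm_smulRight_apply, norm_smul]
    refine mul_le_mul (mul_le_mul ?_ hf' (norm_nonneg _) (by positivity)) hg0
      (norm_nonneg _) (by positivity)
    simp only [norm_neg, norm_inv, norm_pow, Real.norm_eq_abs, abs_of_pos hfpos]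
    gcongr

end ExponentialTilt

theorem strictAntiOn_Icc_of_derivWithin_neg {σ : ℝ → ℝ}
    (hσC1 : ContDiffOn ℝ 1 σ (Set.Icc 0 1))
    (hσ' : ∀ t ∈ Set.Ico (0 : ℝ) 1, derivWithin σ (Set.Icc 0 1) t < 0) :
    StrictAntiOn σ (Set.Icc 0 1) := by
  refine strictAntiOn_of_deriv_neg (convex_Icc 0 1) hσC1.continuousOn fun t ht => ?_
  rw [interior_Icc] at ht
  rw [← derivWithin_of_mem_nhds (Icc_mem_nhds ht.1 ht.2)]
  exact hσ' t ⟨ht.1.le, ht.2⟩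

/-- Local gradient bounds for the drift component
`D_t(x) = 𝔼[η e^{−|x−β_tη−σ_tx₀|²/(2εβ_tσ_t)}] / 𝔼[e^{−|x−β_tη−σ_tx₀|²/(2εβ_tσ_t)}]`
when `η` has all exponential moments and the initial point `x₀` is deterministic:
each `D_t` is differentiable and `∇ₓD_t(x)` is bounded uniformly over `t ∈ (0, t₀]`,
`|x| ≤ R`. -/
theorem drift_D_gradient_locally_bounded
    {d : ℕ} {Ω : Type*} [MeasurableSpace Ω] (P : Measure Ω) [IsProbabilityMeasure P]
    (η : Ω → EuclideanSpace ℝ (Fin d)) (hη : Measurable η)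
    (hexp : ∀ l : ℝ, 0 < l → Integrable (fun ω => Real.exp (l * ‖η ω‖)) P)
    (x₀ : EuclideanSpace ℝ (Fin d)) (ε : ℝ) (hε : 0 < ε)
    (σ β : ℝ → ℝ)
    (hσC1 : ContDiffOn ℝ 1 σ (Set.Icc 0 1))
    (hσmem : ∀ t ∈ Set.Icc (0 : ℝ) 1, σ t ∈ Set.Icc (0 : ℝ) 1)
    (hβmem : ∀ t ∈ Set.Icc (0 : ℝ) 1, β t ∈ Set.Icc (0 : ℝ) 1)
    (hβσ : ∀ t ∈ Set.Icc (0 : ℝ) 1, β t = 1 - σ t)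
    (hσ0 : σ 0 = 1) (hσ1 : σ 1 = 0)
    (hσ' : ∀ t ∈ Set.Ico (0 : ℝ) 1, derivWithin σ (Set.Icc 0 1) t < 0)
    (D : ℝ → EuclideanSpace ℝ (Fin d) → EuclideanSpace ℝ (Fin d))
    (hD : ∀ t ∈ Set.Ioo (0 : ℝ) 1, ∀ x, D t x =
      (∫ ω, Real.exp (-‖x - β t • η ω - σ t • x₀‖ ^ 2 / (2 * ε * β t * σ t)) ∂P)⁻¹
        • ∫ ω, Real.exp (-‖x - β t • η ω - σ t • x₀‖ ^ 2 / (2 * ε * β t * σ t)) • η ω ∂P) :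
    (∀ t ∈ Set.Ioo (0 : ℝ) 1, ∀ x, DifferentiableAt ℝ (D t) x) ∧
      ∀ t₀ ∈ Set.Ioo (0 : ℝ) 1, ∀ R : ℝ, 0 < R →
        ∃ M : ℝ, ∀ t ∈ Set.Ioc (0 : ℝ) t₀, ∀ x : EuclideanSpace ℝ (Fin d),
          ‖x‖ ≤ R → ‖fderiv ℝ (D t) x‖ ≤ M := by
  have hanti := strictAntiOn_Icc_of_derivWithin_neg hσC1 hσ'
  have hσpos : ∀ t ∈ Set.Ioo (0 : ℝ) 1, 0 < σ t := fun t ht =>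
    hσ1 ▸ hanti ⟨ht.1.le, ht.2.le⟩ (Set.right_mem_Icc.mpr zero_le_one) ht.2
  have hβpos : ∀ t ∈ Set.Ioo (0 : ℝ) 1, 0 < β t := fun t ht => by
    have h := hanti (Set.left_mem_Icc.mpr zero_le_one) ⟨ht.1.le, ht.2.le⟩ ht.1
    rw [hβσ t ⟨ht.1.le, ht.2.le⟩]
    linarith
  have hDtilt : ∀ t ∈ Set.Ioo (0 : ℝ) 1, D t = fun x =>
      tiltMean P η (β t / (2 * ε * σ t)) ((ε * σ t)⁻¹ • (x - σ t • x₀)) := fun t ht => by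
    funext x
    rw [hD t ht x]
    exact gaussian_mean_eq_tiltMean hε.ne' (hβpos t ht).ne' (hσpos t ht).ne'
  have key : ∀ t₀ ∈ Set.Ioo (0 : ℝ) 1, ∀ R : ℝ, 0 < R → ∃ M : ℝ, ∀ t ∈ Set.Ioc (0 : ℝ) t₀,
      ∀ x : EuclideanSpace ℝ (Fin d), ‖x‖ ≤ R →
        ∃ A : EuclideanSpace ℝ (Fin d) →L[ℝ] EuclideanSpace ℝ (Fin d),
          HasFDerivAt (D t) A x ∧ ‖A‖ ≤ M := by
    intro t₀ ht₀ R hR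
    have hs₀ := hσpos t₀ ht₀
    obtain ⟨M, hM⟩ := exists_hasFDerivAt_tiltMean_norm_le hη hexp
      (L := (ε * σ t₀)⁻¹ * (R + ‖x₀‖)) (C := 1 / (2 * ε * σ t₀)) (by positivity) (by positivity)
    refine ⟨M * (ε * σ t₀)⁻¹, fun t ht x hx => ?_⟩
    have ht1 : t ∈ Set.Ioo (0 : ℝ) 1 := ⟨ht.1, ht.2.trans_lt ht₀.2⟩
    have htI : t ∈ Set.Icc (0 : ℝ) 1 := Set.Ioo_subset_Icc_self ht1
    have hs := hσpos t ht1
    have hb := hβpos t ht1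
    have hle : σ t₀ ≤ σ t := hanti.antitoneOn htI (Set.Ioo_subset_Icc_self ht₀) ht.2
    have hinv : (ε * σ t)⁻¹ ≤ (ε * σ t₀)⁻¹ := by gcongr
    have hnorm : ‖(ε * σ t)⁻¹‖ = (ε * σ t)⁻¹ := Real.norm_of_nonneg (by positivity)
    have hy : ‖(ε * σ t)⁻¹ • (x - σ t • x₀)‖ ≤ (ε * σ t₀)⁻¹ * (R + ‖x₀‖) := by
      rw [norm_smul, hnorm]
      refine mul_le_mul hinv ?_ (norm_nonneg _) (by positivity)
      refine (norm_sub_le _ _).trans (add_le_add hx ?_)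
      rw [norm_smul, Real.norm_of_nonneg hs.le]
      exact mul_le_of_le_one_left (norm_nonneg _) (hσmem t htI).2
    have hc : β t / (2 * ε * σ t) ≤ 1 / (2 * ε * σ t₀) := by
      gcongr
      exact (hβmem t htI).2
    obtain ⟨A, hA, hAM⟩ := hM _ (by positivity) hc _ hy
    have hlin := ((hasFDerivAt_id (𝕜 := ℝ) x).sub_const (σ t • x₀)).const_smul (ε * σ t)⁻¹
    have hcomp := HasFDerivAt.comp x hA hlin
    refine ⟨_, hcomp.congr_of_eventuallyEq (hDtilt t ht1).eventuallyEq, ?_⟩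
    refine (ContinuousLinearMap.opNorm_comp_le _ _).trans
      (mul_le_mul hAM ?_ (norm_nonneg _) ((norm_nonneg _).trans hAM))
    rw [norm_smul, hnorm]
    exact (mul_le_of_le_one_right (by positivity) ContinuousLinearMap.norm_id_le).trans hinv
  refine ⟨fun t ht x => ?_, fun t₀ ht₀ R hR => ?_⟩
  · obtain ⟨M, hM⟩ := key t ht (‖x‖ + 1) (by positivity)
    obtain ⟨A, hA, -⟩ := hM t ⟨ht.1, le_rfl⟩ x (by linarith)
    exact hA.differentiableAt
  · obtain ⟨M, hM⟩ := key t₀ ht₀ R hR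
    refine ⟨M, fun t ht x hx => ?_⟩
    obtain ⟨A, hA, hAM⟩ := hM t ht x hx
    rwa [hA.fderiv]
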